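/- arXiv:0708.2202 — 3 statements merged into one kernel-verified Lean document; each statement's English description precedes it below -/
import Mathlib

section
/- Radford's S⁴ formula: for every a ∈ A one has S⁴(a) = δ⁻¹ · (Σ ε(σ(a₍₁₎)) · a₍₂₎ · ε(σ(S(a₍₃₎)))) · δ. (Equivalently, S⁴(a) = δ⁻¹ (δ̂ ⊳ a ⊲ δ̂⁻¹) δ, where the modular element δ̂ of the dual acts through the character ε∘σ = δ̂⁻¹ and its convolution inverse ε∘σ∘S = δ̂.) -/
open TensorProduct HopfAlgebra

/-- `f ⊳ a = Σ a₍₁₎ f(a₍₂₎)` : the standard left action of a linear functional on `A`. -/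
noncomputable def lAct {A : Type*} [Ring A] [HopfAlgebra ℂ A] (f : A →ₗ[ℂ] ℂ) : A →ₗ[ℂ] A :=
  (TensorProduct.rid ℂ A).toLinearMap ∘ₗ LinearMap.lTensor A f ∘ₗ Coalgebra.comul

/-- `a ⊲ f = Σ f(a₍₁₎) a₍₂₎` : the standard right action of a linear functional on `A`. -/
noncomputable def rAct {A : Type*} [Ring A] [HopfAlgebra ℂ A] (f : A →ₗ[ℂ] ℂ) : A →ₗ[ℂ] A :=
  (TensorProduct.lid ℂ A).toLinearMap ∘ₗ LinearMap.rTensor A f ∘ₗ Coalgebra.comul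

namespace RadfordFormula

open Coalgebra LinearMap

section Slice

variable {R A B : Type*} [CommSemiring R] [AddCommMonoid A] [Module R A] [AddCommMonoid B]
  [Module R B]

/-- The slice map `id ⊗ f`. -/
noncomputable def sliceRight (f : B →ₗ[R] R) : A ⊗[R] B →ₗ[R] A :=
  (TensorProduct.rid R A).toLinearMap ∘ₗ LinearMap.lTensor A f

/-- The slice map `f ⊗ id`. -/
noncomputable def sliceLeft (f : A →ₗ[R] R) : A ⊗[R] B →ₗ[R] B :=
  (TensorProduct.lid R B).toLinearMap ∘ₗ LinearMap.rTensor B f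

@[simp] lemma sliceRight_tmul (f : B →ₗ[R] R) (x : A) (y : B) :
    sliceRight f (x ⊗ₜ[R] y) = f y • x := by
  simp [sliceRight]

@[simp] lemma sliceLeft_tmul (f : A →ₗ[R] R) (x : A) (y : B) :
    sliceLeft f (x ⊗ₜ[R] y) = f x • y := by
  simp [sliceLeft]

lemma apply_sliceRight (f : B →ₗ[R] R) (g : A →ₗ[R] R) (t : A ⊗[R] B) :
    g (sliceRight f t) = f (sliceLeft g t) := by
  induction t with
  | zero => simp
  | tmul x y => simp [mul_comm]
  | add x y hx hy => simp [hx, hy]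

lemma sliceRight_map {A' B' : Type*} [AddCommMonoid A'] [Module R A'] [AddCommMonoid B']
    [Module R B'] (f : B' →ₗ[R] R) (g : A →ₗ[R] A') (h : B →ₗ[R] B') (t : A ⊗[R] B) :
    sliceRight f (TensorProduct.map g h t) = g (sliceRight (f ∘ₗ h) t) := by
  induction t with
  | zero => simp
  | tmul x y => simp
  | add x y hx hy => simp [hx, hy]

lemma sliceLeft_map {A' B' : Type*} [AddCommMonoid A'] [Module R A'] [AddCommMonoid B']
    [Module R B'] (f : A' →ₗ[R] R) (g : A →ₗ[R] A') (h : B →ₗ[R] B') (t : A ⊗[R] B) :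
    sliceLeft f (TensorProduct.map g h t) = h (sliceLeft (f ∘ₗ g) t) := by
  induction t with
  | zero => simp
  | tmul x y => simp
  | add x y hx hy => simp [hx, hy]

lemma sliceRight_comm (f : A →ₗ[R] R) (t : A ⊗[R] B) :
    sliceRight f (TensorProduct.comm R A B t) = sliceLeft f t := by
  induction t with
  | zero => simp
  | tmul x y => simp
  | add x y hx hy => simp [hx, hy]

end Slice

section Separating

variable {K A B ι : Type*} [Field K] [AddCommGroup A] [Module K A] [AddCommGroup B] [Module K B]

/-- If the functionals `ω i` separate points, their slices determine all right slices. -/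
lemma sliceRight_eq_of_separating {ω : ι → B →ₗ[K] K}
    (hω : ∀ y, (∀ i, ω i y = 0) → y = 0) {s t : A ⊗[K] B}
    (h : ∀ i, sliceRight (ω i) s = sliceRight (ω i) t) (f : B →ₗ[K] K) :
    sliceRight f s = sliceRight f t := by
  refine (Module.forall_dual_apply_eq_zero_iff K _).mp (fun g => ?_) |> sub_eq_zero.mp
  rw [map_sub, apply_sliceRight, apply_sliceRight, ← map_sub, hω (_ - _) ?_, map_zero]
  intro i
  rw [map_sub, ← apply_sliceRight, ← apply_sliceRight, h, sub_self]

/-- If the functionals `ω i` separate points, their slices determine all left slices. -/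
lemma sliceLeft_eq_of_separating {ω : ι → A →ₗ[K] K}
    (hω : ∀ x, (∀ i, ω i x = 0) → x = 0) {s t : A ⊗[K] B}
    (h : ∀ i, sliceLeft (ω i) s = sliceLeft (ω i) t) (f : A →ₗ[K] K) :
    sliceLeft f s = sliceLeft f t := by
  refine (Module.forall_dual_apply_eq_zero_iff K _).mp (fun g => ?_) |> sub_eq_zero.mp
  rw [map_sub, ← apply_sliceRight, ← apply_sliceRight, ← map_sub, hω (_ - _) ?_, map_zero]
  intro i
  rw [map_sub, apply_sliceRight, apply_sliceRight, h, sub_self]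

end Separating

section Coassoc

variable {R A : Type*} [CommSemiring R] [AddCommMonoid A] [Module R A] [Coalgebra R A]

lemma sliceRight_counit_comul (a : A) : sliceRight (counit (R := R)) (comul a) = a := by
  simp [sliceRight]

lemma sliceLeft_counit_comul (a : A) : sliceLeft (counit (R := R)) (comul a) = a := by
  simp [sliceLeft]

lemma sum_left_tmul_comul_right (a : A) :
    ∑ i ∈ (ℛ R a).index, (ℛ R a).left i ⊗ₜ[R] comul (R := R) ((ℛ R a).right i) =
      TensorProduct.assoc R A A A
        (∑ i ∈ (ℛ R a).index, comul (R := R) ((ℛ R a).left i) ⊗ₜ[R] (ℛ R a).right i) := by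
  have h := (Coalgebra.coassoc_apply (R := R) a).symm
  rw [← (ℛ R a).eq] at h
  simpa using h

lemma sliceLeft_comul_sliceRight_comul (f g : A →ₗ[R] R) (a : A) :
    sliceLeft f (comul (sliceRight g (comul a))) =
      sliceRight g (comul (sliceLeft f (comul a))) := by
  have h := congrArg (sliceLeft f ∘ₗ LinearMap.lTensor A (sliceRight g))
    (sum_left_tmul_comul_right (R := R) a)
  have key : ∀ (t : A ⊗[R] A) (y : A), (sliceLeft f ∘ₗ LinearMap.lTensor A (sliceRight g))
      (TensorProduct.assoc R A A A (t ⊗ₜ y)) = g y • sliceLeft f t := by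
    intro t y
    induction t with
    | zero => simp
    | tmul x z => simp [smul_smul, mul_comm]
    | add x z hx hz => simp only [add_tmul, map_add, hx, hz, smul_add]
  simp only [map_sum, key] at h
  rw [← (ℛ R a).eq]
  simp only [map_sum, sliceLeft_tmul, sliceRight_tmul, map_smul]
  simpa using h.symm

end Coassoc

section Hopf

variable {R A : Type*} [CommSemiring R] [Semiring A] [HopfAlgebra R A]

/-- `Σ (S(a₍₁₎) ⊗ 1) Δ(a₍₂₎) = 1 ⊗ a`. -/
lemma sum_antipode_left_mul_comul_right (a : A) :
    ∑ i ∈ (ℛ R a).index,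
      (antipode R ((ℛ R a).left i) ⊗ₜ[R] (1 : A)) * comul (R := R) ((ℛ R a).right i) =
      1 ⊗ₜ[R] a := by
  let T : A ⊗[R] (A ⊗[R] A) →ₗ[R] A ⊗[R] A :=
    LinearMap.rTensor A (mul' R A ∘ₗ LinearMap.rTensor A (antipode R)) ∘ₗ
      (TensorProduct.assoc R A A A).symm.toLinearMap
  have hT : ∀ (x : A) (t : A ⊗[R] A), T (x ⊗ₜ t) = (antipode R x ⊗ₜ[R] (1 : A)) * t := by
    intro x t
    induction t with
    | zero => simp
    | tmul y z => simp [T]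
    | add y z hy hz => simp only [tmul_add, map_add, hy, hz, mul_add]
  have h := congrArg T (sum_left_tmul_comul_right (R := R) a)
  simp only [map_sum, hT] at h
  rw [h]
  simp only [T, LinearMap.comp_apply, LinearEquiv.coe_coe, LinearEquiv.symm_apply_apply,
    LinearMap.rTensor_tmul, mul_antipode_rTensor_comul_apply]
  simp only [Algebra.algebraMap_eq_smul_one, smul_tmul, ← tmul_sum, sum_counit_smul]

/-- `Σ Δ(a₍₁₎) (1 ⊗ S(a₍₂₎)) = a ⊗ 1`. -/
lemma sum_comul_left_mul_antipode_right (a : A) :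
    ∑ i ∈ (ℛ R a).index,
      comul (R := R) ((ℛ R a).left i) * ((1 : A) ⊗ₜ[R] antipode R ((ℛ R a).right i)) =
      a ⊗ₜ[R] 1 := by
  let T : A ⊗[R] (A ⊗[R] A) →ₗ[R] A ⊗[R] A :=
    LinearMap.lTensor A (mul' R A ∘ₗ LinearMap.lTensor A (antipode R))
  have hT : ∀ (t : A ⊗[R] A) (x : A), T (TensorProduct.assoc R A A A (t ⊗ₜ x)) =
      t * ((1 : A) ⊗ₜ[R] antipode R x) := by
    intro t x
    induction t with
    | zero => simp
    | tmul y z => simp [T]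
    | add y z hy hz => simp only [add_tmul, map_add, hy, hz, add_mul]
  have h := congrArg T (sum_left_tmul_comul_right (R := R) a)
  simp only [map_sum, hT] at h
  rw [← h]
  simp only [T, LinearMap.comp_apply, LinearMap.lTensor_tmul, mul_antipode_lTensor_comul_apply]
  have hε := congrArg (LinearMap.lTensor A (Algebra.linearMap R A))
    (sum_tmul_counit_eq (R := R) (ℛ R a))
  simpa only [map_sum, LinearMap.lTensor_tmul, Algebra.linearMap_apply, map_one] using hε

/-- The antipode is an anti-homomorphism of coalgebras. -/
lemma comul_antipode (a : A) :
    comul (R := R) (antipode R a) =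
      TensorProduct.map (antipode R) (antipode R) (TensorProduct.comm R A A (comul a)) := by
  let G : A →ₗ[R] A ⊗[R] A :=
    TensorProduct.map (antipode R) (antipode R) ∘ₗ (TensorProduct.comm R A A).toLinearMap ∘ₗ comul
  have hG : WithConv.toConv G * WithConv.toConv (comul (R := R) (A := A)) = 1 := by
    ext a
    let T : A ⊗[R] (A ⊗[R] A) →ₗ[R] A ⊗[R] A :=
      mul' R (A ⊗[R] A) ∘ₗ TensorProduct.map (TensorProduct.mk R A A 1 ∘ₗ antipode R)
        (mul' R (A ⊗[R] A) ∘ₗ TensorProduct.map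
          ((TensorProduct.mk R A A).flip 1 ∘ₗ antipode R) comul)
    have hT : ∀ (t : A ⊗[R] A) (x : A), T (TensorProduct.assoc R A A A (t ⊗ₜ x)) =
        TensorProduct.map (antipode R) (antipode R) (TensorProduct.comm R A A t) *
          comul (R := R) x := by
      intro t x
      induction t with
      | zero => simp
      | tmul y z => simp [T, ← mul_assoc]
      | add y z hy hz => simp only [add_tmul, map_add, hy, hz, add_mul]
    have hT2 : ∀ x y : A, T (x ⊗ₜ comul (R := R) y) = 1 ⊗ₜ (antipode R x * y) := by
      intro x y
      rw [← one_mul (1 : A), ← Algebra.TensorProduct.tmul_mul_tmul,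
        ← sum_antipode_left_mul_comul_right (R := R) y]
      conv_lhs => rw [← (ℛ R y).eq]
      simp [T]
    have h := congrArg T (sum_left_tmul_comul_right (R := R) a)
    simp only [map_sum, hT, hT2] at h
    rw [(ℛ R a).convMul_apply]
    refine Eq.trans h.symm ?_
    rw [← tmul_sum, sum_antipode_mul_eq_algebraMap_counit]
    simp [Algebra.algebraMap_eq_smul_one, Algebra.TensorProduct.one_def]
  have h := left_inv_eq_right_inv hG LinearMap.comul_right_inv
  exact (LinearMap.congr_fun (WithConv.toConv_injective h) a).symm

/-- The convolution inverse of a character `χ` is `χ ∘ S`. -/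
lemma sliceRight_comul_sliceRight_comul_antipode (χ : A →ₐ[R] R) (a : A) :
    sliceRight χ.toLinearMap (comul (sliceRight (χ.toLinearMap ∘ₗ antipode R) (comul a))) = a := by
  have h := congrArg (sliceRight χ.toLinearMap) (sum_comul_left_mul_antipode_right (R := R) a)
  have key : ∀ (t : A ⊗[R] A) (x : A), sliceRight χ.toLinearMap (t * ((1 : A) ⊗ₜ[R] x)) =
      χ x • sliceRight χ.toLinearMap t := by
    intro t x
    induction t with
    | zero => simp
    | tmul y z => simp [smul_smul, mul_comm]
    | add y z hy hz => simp only [map_add, hy, hz, add_mul, smul_add]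
  simp only [map_sum, key] at h
  conv_lhs => rw [← (ℛ R a).eq]
  simpa using h

/-- Strong left invariance: `S((id ⊗ φ)(Δ(a)(1 ⊗ b))) = (id ⊗ φ)((1 ⊗ a)Δ(b))`. -/
lemma antipode_sliceRight_comul {φ : A →ₗ[R] R}
    (hφ : ∀ a : A, sliceRight φ (comul a) = φ a • (1 : A)) (a b : A) :
    antipode R (sliceRight (φ ∘ₗ mulRight R b) (comul a)) =
      sliceRight (φ ∘ₗ mulLeft R a) (comul b) := by
  have key : ∀ (x : A) (t : A ⊗[R] A),
      sliceRight φ ((x ⊗ₜ[R] (1 : A)) * t) = x * sliceRight φ t := by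
    intro x t
    induction t with
    | zero => simp
    | tmul y z => simp
    | add y z hy hz => simp only [map_add, hy, hz, mul_add]
  have key' : ∀ t : A ⊗[R] A,
      sliceRight φ (((1 : A) ⊗ₜ[R] a) * t) = sliceRight (φ ∘ₗ mulLeft R a) t := by
    intro t
    induction t with
    | zero => simp
    | tmul y z => simp
    | add y z hy hz => simp only [map_add, hy, hz, mul_add]
  rw [← key', ← sum_antipode_left_mul_comul_right, Finset.sum_mul]
  conv_lhs => rw [← (ℛ R a).eq]
  simp [mul_assoc, key, ← Bialgebra.comul_mul, hφ]

/-- Strong invariance on the other side, for a functional with `(φ ⊗ id)Δ = φ(·)δ`. -/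
lemma sliceLeft_comul_eq_mul_antipode {φ : A →ₗ[R] R} {δ : A}
    (hφ : ∀ a : A, sliceLeft φ (comul a) = φ a • δ) (a b : A) :
    sliceLeft (φ ∘ₗ mulRight R b) (comul a) =
      δ * antipode R (sliceLeft (φ ∘ₗ mulLeft R a) (comul b)) := by
  have key : ∀ (x : A) (t : A ⊗[R] A),
      sliceLeft φ (t * ((1 : A) ⊗ₜ[R] x)) = sliceLeft φ t * x := by
    intro x t
    induction t with
    | zero => simp
    | tmul y z => simp
    | add y z hy hz => simp only [map_add, hy, hz, add_mul]
  have key' : ∀ t : A ⊗[R] A,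
      sliceLeft φ (t * (b ⊗ₜ[R] (1 : A))) = sliceLeft (φ ∘ₗ mulRight R b) t := by
    intro t
    induction t with
    | zero => simp
    | tmul y z => simp
    | add y z hy hz => simp only [map_add, hy, hz, add_mul]
  rw [← key', ← sum_comul_left_mul_antipode_right, Finset.mul_sum]
  conv_rhs => rw [← (ℛ R b).eq]
  simp [← mul_assoc, key, ← Bialgebra.comul_mul, hφ, Finset.mul_sum]

/-- A left invariant `φ` with `φ ∘ S = φ(· δ)` satisfies `(φ ⊗ id)Δ = φ(·)δ`. -/
lemma sliceLeft_comul_eq_smul_modular {φ : A →ₗ[R] R}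
    (hS : Function.Injective (antipode R (A := A)))
    (hφ : ∀ a : A, sliceRight φ (comul a) = φ a • (1 : A)) (δ : Aˣ)
    (hδΔ : comul (R := R) (δ : A) = (δ : A) ⊗ₜ[R] (δ : A))
    (hδ : ∀ a : A, φ (antipode R a) = φ (a * δ)) (a : A) :
    sliceLeft φ (comul a) = φ a • (δ : A) := by
  have hψ : ∀ x : A, sliceLeft (φ ∘ₗ antipode R) (comul x) = φ (x * δ) • (1 : A) := by
    intro x
    apply hS
    rw [← sliceRight_comm, ← sliceRight_map, ← comul_antipode, hφ, hδ, map_smul, antipode_one]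
  have hφS : φ ∘ₗ antipode R = φ ∘ₗ mulRight R (δ : A) := by
    ext x
    simp [hδ]
  have key : ∀ t : A ⊗[R] A,
      sliceLeft φ (t * ((δ : A) ⊗ₜ[R] (δ : A))) = sliceLeft (φ ∘ₗ mulRight R (δ : A)) t * δ := by
    intro t
    induction t with
    | zero => simp
    | tmul y z => simp
    | add y z hy hz => simp only [map_add, hy, hz, add_mul]
  have h := key (comul (a * (↑δ⁻¹ : A)))
  rw [← hδΔ, ← Bialgebra.comul_mul, ← hφS, hψ] at h
  simpa using h

end Hopf

section Modular

variable {K A : Type*} [Field K] [Ring A] [HopfAlgebra K A] {φ : A →ₗ[K] K} (σ : A ≃ₐ[K] A)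

/-- `σ = S² ∘ (id ⊗ εσ) ∘ Δ` for the modular automorphism `σ` of a left integral. -/
lemma modularAut_eq_antipode_sq
    (hφ : ∀ a : A, sliceRight φ (comul a) = φ a • (1 : A))
    (hφf : ∀ a : A, (∀ b : A, φ (b * a) = 0) → a = 0)
    (hσ : ∀ a b : A, φ (a * b) = φ (b * σ a)) (a : A) :
    σ a = antipode K (antipode K (sliceRight (counit ∘ₗ σ.toLinearMap) (comul a))) := by
  have h1 : ∀ b : A, φ ∘ₗ mulRight K b = (φ ∘ₗ mulLeft K b) ∘ₗ σ.toLinearMap := fun b =>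
    LinearMap.ext fun x => hσ x b
  have h2 : ∀ b : A, φ ∘ₗ mulRight K (σ b) = φ ∘ₗ mulLeft K b := fun b =>
    LinearMap.ext fun x => (hσ b x).symm
  have h := sliceRight_eq_of_separating (ω := fun b => φ ∘ₗ mulLeft K b)
    (s := comul (σ a))
    (t := TensorProduct.map (antipode K ∘ₗ antipode K) σ.toLinearMap (comul a))
    (fun y hy => hφf y hy) (fun b => by
      rw [sliceRight_map, ← h1, LinearMap.comp_apply, antipode_sliceRight_comul hφ,
        ← antipode_sliceRight_comul hφ, h2]) counit
  rwa [sliceRight_counit_comul, sliceRight_map] at h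

/-- `δ S²(σ(a)) δ⁻¹ = (εσ ⊗ id)(Δ(a))` for the modular automorphism `σ` of a functional with
`(φ ⊗ id)Δ = φ(·)δ`. -/
lemma sliceLeft_counit_modularAut (δ : Aˣ) (hδ : antipode K (δ : A) = (↑δ⁻¹ : A))
    (hφ : ∀ a : A, sliceLeft φ (comul a) = φ a • (δ : A))
    (hφf : ∀ a : A, (∀ b : A, φ (b * a) = 0) → a = 0)
    (hσ : ∀ a b : A, φ (a * b) = φ (b * σ a)) (a : A) :
    sliceLeft (counit ∘ₗ σ.toLinearMap) (comul a) =
      δ * antipode K (antipode K (σ a)) * (↑δ⁻¹ : A) := by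
  have h1 : ∀ b : A, φ ∘ₗ mulRight K b = (φ ∘ₗ mulLeft K b) ∘ₗ σ.toLinearMap := fun b =>
    LinearMap.ext fun x => hσ x b
  have h2 : ∀ b : A, φ ∘ₗ mulRight K (σ b) = φ ∘ₗ mulLeft K b := fun b =>
    LinearMap.ext fun x => (hσ b x).symm
  have h := sliceLeft_eq_of_separating (ω := fun b => φ ∘ₗ mulLeft K b)
    (s := TensorProduct.map σ.toLinearMap LinearMap.id (comul a))
    (t := TensorProduct.map LinearMap.id
      (mulRight K (↑δ⁻¹ : A) ∘ₗ mulLeft K (δ : A) ∘ₗ antipode K ∘ₗ antipode K) (comul (σ a)))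
    (fun y hy => hφf y hy) (fun b => by
      rw [sliceLeft_map, sliceLeft_map, ← h1, LinearMap.comp_id, LinearMap.id_apply,
        sliceLeft_comul_eq_mul_antipode hφ, ← h2, sliceLeft_comul_eq_mul_antipode hφ,
        antipode_mul_antidistrib, hδ]
      simp [mul_assoc]) counit
  rw [sliceLeft_map, sliceLeft_map, LinearMap.comp_id, sliceLeft_counit_comul] at h
  simpa using h

end Modular

end RadfordFormula

/-- Radford's S⁴ formula: `S⁴(a) = δ⁻¹ (δ̂ ⊳ a ⊲ δ̂⁻¹) δ`, where `δ̂ = ε∘σ∘S` and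
`δ̂⁻¹ = ε∘σ`, i.e. `S⁴(a) = δ⁻¹ (Σ ε(σ(a₍₁₎)) a₍₂₎ ε(σ(S(a₍₃₎)))) δ`. -/
theorem radford_S4_formula
    {A : Type*} [Ring A] [HopfAlgebra ℂ A]
    (hS : Function.Bijective (antipode (R := ℂ) (A := A)))
    (φ : A →ₗ[ℂ] ℂ) (hφ0 : φ ≠ 0)
    (hφL : ∀ a : A,
      (TensorProduct.rid ℂ A) (LinearMap.lTensor A φ (Coalgebra.comul a)) = φ a • (1 : A))
    (hφf1 : ∀ a : A, (∀ b : A, φ (a * b) = 0) → a = 0)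
    (hφf2 : ∀ a : A, (∀ b : A, φ (b * a) = 0) → a = 0)
    (σ : A ≃ₐ[ℂ] A) (hσ : ∀ a b : A, φ (a * b) = φ (b * σ a))
    (δ : Aˣ)
    (hδΔ : Coalgebra.comul (R := ℂ) ((δ : A)) = (δ : A) ⊗ₜ[ℂ] (δ : A))
    (hδε : Coalgebra.counit (R := ℂ) ((δ : A)) = 1)
    (hδ : ∀ a : A, φ (antipode (R := ℂ) a) = φ (a * δ)) :
    ∀ a : A,
      antipode (R := ℂ) (antipode (R := ℂ) (antipode (R := ℂ) (antipode (R := ℂ) a))) =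
        (↑δ⁻¹ : A) *
          lAct (Coalgebra.counit ∘ₗ σ.toLinearMap ∘ₗ antipode (R := ℂ))
            (rAct (Coalgebra.counit ∘ₗ σ.toLinearMap) a) * (δ : A) := by
  intro a
  have hφ : ∀ a : A, RadfordFormula.sliceRight φ (Coalgebra.comul a) = φ a • (1 : A) := hφL
  have hSδ : antipode ℂ (δ : A) = (↑δ⁻¹ : A) :=
    eq_comm.mp (Units.inv_eq_of_mul_eq_one_right
      (IsGroupLikeElem.mul_antipode_cancel (R := ℂ) ⟨hδε, hδΔ⟩))
  have hφR := RadfordFormula.sliceLeft_comul_eq_smul_modular hS.1 hφ δ hδΔ hδ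
  let χ : A →ₐ[ℂ] ℂ := (Bialgebra.counitAlgHom ℂ A).comp σ.toAlgHom
  let b := RadfordFormula.sliceRight (χ.toLinearMap ∘ₗ antipode ℂ) (Coalgebra.comul (R := ℂ) a)
  have hb : RadfordFormula.sliceRight (Coalgebra.counit ∘ₗ σ.toLinearMap)
      (Coalgebra.comul (R := ℂ) b) = a :=
    RadfordFormula.sliceRight_comul_sliceRight_comul_antipode χ a
  have h1 := RadfordFormula.modularAut_eq_antipode_sq σ hφ hφf2 hσ b
  have h2 := RadfordFormula.sliceLeft_counit_modularAut σ δ hSδ hφR hφf2 hσ b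
  rw [h1, hb] at h2
  have h3 : lAct (Coalgebra.counit ∘ₗ σ.toLinearMap ∘ₗ antipode (R := ℂ))
      (rAct (Coalgebra.counit ∘ₗ σ.toLinearMap) a) =
      RadfordFormula.sliceLeft (Coalgebra.counit ∘ₗ σ.toLinearMap) (Coalgebra.comul b) :=
    (RadfordFormula.sliceLeft_comul_sliceRight_comul _ _ a).symm
  rw [h3, h2]
  simp [mul_assoc]
end

section
/- The dual comultiplication maps into the multiplier algebra: for all a, a' ∈ A there exist finitely many c₁, …, cₙ, d₁, …, dₙ ∈ A such that Σ φ(x·y₍₁₎·a)·φ(y₍₂₎·a') = Σᵢ φ(x·cᵢ)·φ(y·dᵢ) for all x, y ∈ A; and there exist finitely many c'₁, …, c'ₘ, d'₁, …, d'ₘ ∈ A such that Σ φ(x₍₁₎·a)·φ(x₍₂₎·y·a') = Σⱼ φ(x·c'ⱼ)·φ(y·d'ⱼ) for all x, y ∈ A. (These express Δ̂(b)(1⊗b') ∈ Â⊗Â and (Â⊗1)Δ̂(Â) ⊆ Â⊗Â for b = φ(·a), b' = φ(·a') in the dual = {φ(·a) : a ∈ A}.) -/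
open TensorProduct HopfAlgebra

namespace HopfAlgebra

open Coalgebra WithConv MulOpposite

section Semiring

variable {R A : Type*} [CommSemiring R] [Semiring A] [HopfAlgebra R A]

theorem comul_antipode (a : A) :
    comul (R := R) (antipode R a) =
      TensorProduct.map (antipode R) (antipode R) (TensorProduct.comm R A A (comul a)) := by
  let i₁ : A →ₐ[R] A ⊗[R] A := Algebra.TensorProduct.includeLeft
  let i₂ : A →ₐ[R] A ⊗[R] A := Algebra.TensorProduct.includeRight
  let G : WithConv (A →ₗ[R] A ⊗[R] A) := toConv (TensorProduct.map (antipode R) (antipode R) ∘ₗ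
    (TensorProduct.comm R A A).toLinearMap ∘ₗ comul)
  let D : WithConv (A →ₗ[R] A ⊗[R] A) := toConv comul
  have antipode_mul (i : A →ₐ[R] A ⊗[R] A) :
      toConv (i.toLinearMap ∘ₗ antipode R) * toConv i.toLinearMap = 1 := by
    ext a
    rw [(ℛ R a).convMul_apply]
    simp [← map_mul, ← map_sum, sum_antipode_mul_eq_algebraMap_counit]
  have hD : D = toConv i₁.toLinearMap * toConv i₂.toLinearMap := by
    ext a
    rw [(ℛ R a).convMul_apply]
    simp [D, i₁, i₂, (ℛ R a).eq]
  have hG : G = toConv (i₂.toLinearMap ∘ₗ antipode R) * toConv (i₁.toLinearMap ∘ₗ antipode R) := by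
    ext a
    rw [(ℛ R a).convMul_apply]
    simp [G, i₁, i₂, ← (ℛ R a).eq]
  have hGD : G * D = 1 := by
    rw [hG, hD, mul_assoc, ← mul_assoc _ (toConv i₁.toLinearMap), antipode_mul, one_mul,
      antipode_mul]
  exact congr(($(left_inv_eq_right_inv hGD LinearMap.comul_right_inv)).ofConv a).symm

theorem comp_antipode_right_integral (hS : Function.Injective (antipode R (A := A)))
    {φ : A →ₗ[R] R}
    (hφ : ∀ a : A, TensorProduct.rid R A (φ.lTensor A (comul a)) = φ a • (1 : A)) (a : A) :
    TensorProduct.lid R A ((φ ∘ₗ antipode R).rTensor A (comul a)) =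
      (φ ∘ₗ antipode R) a • (1 : A) := by
  apply hS
  have h := hφ (antipode R a)
  rw [comul_antipode] at h
  simpa [← (ℛ R a).eq] using h

end Semiring

section SkewAntipode

variable {R A : Type*} [CommSemiring R] [Semiring A] [HopfAlgebra R A]
  {T : A →ₗ[R] A}

theorem inverse_antipode_mul (hS : Function.Injective (antipode R (A := A)))
    (hT : Function.RightInverse T (antipode R)) (a b : A) : T (a * b) = T b * T a :=
  hS <| by rw [antipode_mul_antidistrib, hT, hT, hT]

theorem inverse_antipode_convMul_op (hS : Function.Injective (antipode R (A := A)))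
    (hT : Function.RightInverse T (antipode R)) :
    toConv ((opLinearEquiv R).toLinearMap ∘ₗ T) * toConv (opLinearEquiv R (M := A)).toLinearMap
      = 1 := by
  ext a
  rw [(ℛ R a).convMul_apply]
  apply unop_injective
  apply hS
  simpa [antipode_mul_antidistrib, hT _, Algebra.algebraMap_eq_smul_one]
    using sum_mul_antipode_eq_smul (ℛ R a)

theorem op_convMul_inverse_antipode (hS : Function.Injective (antipode R (A := A)))
    (hT : Function.RightInverse T (antipode R)) :
    toConv (opLinearEquiv R (M := A)).toLinearMap * toConv ((opLinearEquiv R).toLinearMap ∘ₗ T)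
      = 1 := by
  ext a
  rw [(ℛ R a).convMul_apply]
  apply unop_injective
  apply hS
  simpa [antipode_mul_antidistrib, hT _, Algebra.algebraMap_eq_smul_one]
    using sum_antipode_mul_eq_smul (ℛ R a)

theorem eq_sum_mul_inverse_antipode_left (hS : Function.Injective (antipode R (A := A)))
    (hT : Function.RightInverse T (antipode R)) {F E : A →ₗ[R] A}
    (h : ∀ a, ∑ i ∈ (ℛ R a).index, F ((ℛ R a).right i) * (ℛ R a).left i = E a) (a : A) :
    F a = ∑ i ∈ (ℛ R a).index, E ((ℛ R a).right i) * T ((ℛ R a).left i) := by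
  let o (f : A →ₗ[R] A) : WithConv (A →ₗ[R] Aᵐᵒᵖ) := toConv ((opLinearEquiv R).toLinearMap ∘ₗ f)
  have hE : o .id * o F = o E := by
    ext a
    rw [(ℛ R a).convMul_apply]
    apply unop_injective
    simpa [o] using h a
  have hF : o F = o T * o E := by
    rw [← hE, ← mul_assoc, show o T * o .id = 1 from inverse_antipode_convMul_op hS hT, one_mul]
  have := congr(unop ($hF a))
  rw [(ℛ R a).convMul_apply] at this
  simpa [o] using this

theorem eq_sum_inverse_antipode_right_mul (hS : Function.Injective (antipode R (A := A)))
    (hT : Function.RightInverse T (antipode R)) {F E : A →ₗ[R] A}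
    (h : ∀ a, ∑ i ∈ (ℛ R a).index, (ℛ R a).right i * F ((ℛ R a).left i) = E a) (a : A) :
    F a = ∑ i ∈ (ℛ R a).index, T ((ℛ R a).right i) * E ((ℛ R a).left i) := by
  let o (f : A →ₗ[R] A) : WithConv (A →ₗ[R] Aᵐᵒᵖ) := toConv ((opLinearEquiv R).toLinearMap ∘ₗ f)
  have hE : o F * o .id = o E := by
    ext a
    rw [(ℛ R a).convMul_apply]
    apply unop_injective
    simpa [o] using h a
  have hF : o F = o E * o T := by
    rw [← hE, mul_assoc, show o .id * o T = 1 from op_convMul_inverse_antipode hS hT, mul_one]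
  have := congr(unop ($hF a))
  rw [(ℛ R a).convMul_apply] at this
  simpa [o] using this

/-- `Σ φ(x₍₂₎ a) x₍₁₎ = Σ φ(x a₍₂₎) S⁻¹(a₍₁₎)` for a left integral `φ`. -/
theorem sum_left_integral_smul (hS : Function.Injective (antipode R (A := A)))
    (hT : Function.RightInverse T (antipode R)) {φ : A →ₗ[R] R}
    (hφ : ∀ a : A, TensorProduct.rid R A (φ.lTensor A (comul a)) = φ a • (1 : A)) (x a : A) :
    ∑ i ∈ (ℛ R x).index, φ ((ℛ R x).right i * a) • (ℛ R x).left i =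
      ∑ i ∈ (ℛ R a).index, φ (x * (ℛ R a).right i) • T ((ℛ R a).left i) := by
  let F : A →ₗ[R] A := ∑ i ∈ (ℛ R x).index,
    (φ ∘ₗ LinearMap.mulLeft R ((ℛ R x).right i)).smulRight ((ℛ R x).left i)
  let E : A →ₗ[R] A := (φ ∘ₗ LinearMap.mulLeft R x).smulRight 1
  have h (a : A) : ∑ i ∈ (ℛ R a).index, F ((ℛ R a).right i) * (ℛ R a).left i = E a := by
    have := hφ (x * a)
    rw [Bialgebra.comul_mul, ← (ℛ R a).eq, ← (ℛ R x).eq] at this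
    simpa [F, E, Finset.sum_mul, Finset.mul_sum] using this
  simpa [F, E] using eq_sum_mul_inverse_antipode_left hS hT h a

/-- `Σ ψ(c x₍₁₎) x₍₂₎ = Σ ψ(c₍₁₎ x) S⁻¹(c₍₂₎)` for a right integral `ψ`. -/
theorem sum_right_integral_smul (hS : Function.Injective (antipode R (A := A)))
    (hT : Function.RightInverse T (antipode R)) {ψ : A →ₗ[R] R}
    (hψ : ∀ a : A, TensorProduct.lid R A (ψ.rTensor A (comul a)) = ψ a • (1 : A)) (c x : A) :
    ∑ i ∈ (ℛ R x).index, ψ (c * (ℛ R x).left i) • (ℛ R x).right i =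
      ∑ i ∈ (ℛ R c).index, ψ ((ℛ R c).left i * x) • T ((ℛ R c).right i) := by
  let F : A →ₗ[R] A := ∑ i ∈ (ℛ R x).index,
    (ψ ∘ₗ LinearMap.mulRight R ((ℛ R x).left i)).smulRight ((ℛ R x).right i)
  let E : A →ₗ[R] A := (ψ ∘ₗ LinearMap.mulRight R x).smulRight 1
  have h (a : A) : ∑ i ∈ (ℛ R a).index, (ℛ R a).right i * F ((ℛ R a).left i) = E a := by
    have := hψ (a * x)
    rw [Bialgebra.comul_mul, ← (ℛ R a).eq, ← (ℛ R x).eq] at this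
    refine Eq.trans ?_ this
    rw [Finset.sum_mul_sum]
    simp [F, Finset.mul_sum]
  simpa [F, E] using eq_sum_inverse_antipode_right_mul hS hT h c

theorem sum_right_integral_mul_left_integral (hS : Function.Injective (antipode R (A := A)))
    (hT : Function.RightInverse T (antipode R)) {φ ψ : A →ₗ[R] R}
    (hφ : ∀ a : A, TensorProduct.rid R A (φ.lTensor A (comul a)) = φ a • (1 : A))
    (hψ : ∀ a : A, TensorProduct.lid R A (ψ.rTensor A (comul a)) = ψ a • (1 : A)) (b x a : A) :
    ∑ i ∈ (ℛ R a).index, φ (x * (ℛ R a).right i) * ψ (b * T ((ℛ R a).left i)) =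
      ∑ i ∈ (ℛ R b).index, ψ ((ℛ R b).left i * x) * φ (T ((ℛ R b).right i) * a) := by
  have h₁ := congr(ψ (b * $(sum_left_integral_smul hS hT hφ x a)))
  have h₂ := congr(φ ($(sum_right_integral_smul hS hT hψ b x) * a))
  simp only [Finset.mul_sum, Finset.sum_mul, map_sum, mul_smul_comm, smul_mul_assoc, map_smul,
    smul_eq_mul] at h₁ h₂
  rw [← h₁, ← h₂]
  exact Finset.sum_congr rfl fun i _ ↦ mul_comm _ _

end SkewAntipode

section Integrals

variable {K A : Type*} [Field K] [Semiring A] [HopfAlgebra K A] {T : A →ₗ[K] A}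
  {φ ψ : A →ₗ[K] K}

theorem exists_left_integral_mul_right_eq (hS : Function.Injective (antipode K (A := A)))
    (hT : Function.RightInverse T (antipode K)) (hT' : Function.LeftInverse T (antipode K))
    (hφ : ∀ a : A, TensorProduct.rid K A (φ.lTensor A (comul a)) = φ a • (1 : A))
    (hψ : ∀ a : A, TensorProduct.lid K A (ψ.rTensor A (comul a)) = ψ a • (1 : A))
    (hψ0 : ψ ≠ 0) (q : A) : ∃ c, ∀ x, φ (x * q) = ψ (c * x) := by
  obtain ⟨p, hp⟩ : ∃ p, ψ (T p) ≠ 0 := by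
    obtain ⟨p, hp⟩ := DFunLike.ne_iff.1 hψ0
    exact ⟨antipode K p, by rwa [hT']⟩
  let b (i : A × A) : A := T (T ((ℛ K q).left i) * p)
  refine ⟨(ψ (T p))⁻¹ • ∑ i ∈ (ℛ K q).index, ∑ j ∈ (ℛ K (b i)).index,
    φ (T ((ℛ K (b i)).right j) * (ℛ K q).right i) • (ℛ K (b i)).left j, fun x ↦ ?_⟩
  let F : A →ₗ[K] A := (φ ∘ₗ LinearMap.mulLeft K x).smulRight 1
  let E : A →ₗ[K] A := (TensorProduct.rid K A).toLinearMap ∘ₗ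
    (φ ∘ₗ LinearMap.mulLeft K x).lTensor A ∘ₗ comul
  have hE (a : A) : E a = ∑ i ∈ (ℛ K a).index, φ (x * (ℛ K a).right i) • (ℛ K a).left i := by
    simp [E, ← (ℛ K a).eq]
  have h := eq_sum_mul_inverse_antipode_left hS hT (F := F) (E := E)
    (fun a ↦ by simp [F, hE]) q
  replace h := congr(ψ (T ($(h) * p)))
  simp only [hE, F, LinearMap.smulRight_apply, LinearMap.comp_apply, LinearMap.mulLeft_apply,
    Finset.sum_mul, map_sum, smul_mul_assoc, one_mul, map_smul, smul_eq_mul, mul_assoc,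
    inverse_antipode_mul hS hT _ (_ * p), sum_right_integral_mul_left_integral hS hT hφ hψ] at h
  rw [smul_mul_assoc, map_smul, smul_eq_mul, eq_inv_mul_iff_mul_eq₀ hp, mul_comm, h]
  simp only [Finset.sum_mul, map_sum, smul_mul_assoc, map_smul, smul_eq_mul, mul_comm, b]

theorem exists_right_integral_mul_left_eq (hS : Function.Injective (antipode K (A := A)))
    (hT : Function.RightInverse T (antipode K))
    (hφ : ∀ a : A, TensorProduct.rid K A (φ.lTensor A (comul a)) = φ a • (1 : A))
    (hψ : ∀ a : A, TensorProduct.lid K A (ψ.rTensor A (comul a)) = ψ a • (1 : A))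
    (hφ0 : φ ≠ 0) (q : A) : ∃ d, ∀ x, ψ (q * x) = φ (x * d) := by
  obtain ⟨p, hp⟩ := DFunLike.ne_iff.1 hφ0
  let a (i : A × A) : A := T (T ((ℛ K q).right i)) * p
  refine ⟨(φ p)⁻¹ • ∑ i ∈ (ℛ K q).index, ∑ j ∈ (ℛ K (a i)).index,
    ψ ((ℛ K q).left i * T ((ℛ K (a i)).left j)) • (ℛ K (a i)).right j, fun x ↦ ?_⟩
  let F : A →ₗ[K] A := (ψ ∘ₗ LinearMap.mulRight K x).smulRight 1
  let E : A →ₗ[K] A := (TensorProduct.lid K A).toLinearMap ∘ₗ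
    (ψ ∘ₗ LinearMap.mulRight K x).rTensor A ∘ₗ comul
  have hE (a : A) : E a = ∑ i ∈ (ℛ K a).index, ψ ((ℛ K a).left i * x) • (ℛ K a).right i := by
    simp [E, ← (ℛ K a).eq]
  have hT1 : T 1 = 1 := hS (by rw [hT, antipode_one])
  have h := eq_sum_inverse_antipode_right_mul hS hT (F := F) (E := E)
    (fun a ↦ by simp [F, hE]) q
  replace h := congr(φ ((T $h) * p))
  simp only [hE, F, LinearMap.smulRight_apply, LinearMap.comp_apply, LinearMap.mulRight_apply,
    Finset.sum_mul, Finset.mul_sum, map_sum, smul_mul_assoc, mul_smul_comm, one_mul, map_smul,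
    smul_eq_mul, hT1, inverse_antipode_mul hS hT, mul_assoc,
    ← sum_right_integral_mul_left_integral hS hT hφ hψ] at h
  rw [mul_smul_comm, map_smul, smul_eq_mul, eq_inv_mul_iff_mul_eq₀ hp, mul_comm, h]
  simp only [Finset.mul_sum, map_sum, mul_smul_comm, map_smul, smul_eq_mul, mul_comm, a]

theorem exists_left_integral_mul_left_eq_right_integral
    (hS : Function.Injective (antipode K (A := A))) (hT : Function.RightInverse T (antipode K))
    (hφ : ∀ a : A, TensorProduct.rid K A (φ.lTensor A (comul a)) = φ a • (1 : A))
    (hψ : ∀ a : A, TensorProduct.lid K A (ψ.rTensor A (comul a)) = ψ a • (1 : A))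
    (hψ0 : ψ ≠ 0) (s : A) : ∃ c, ∀ x, φ (s * x) = ψ (c * x) := by
  obtain ⟨p, hp⟩ := DFunLike.ne_iff.1 hψ0
  refine ⟨((ψ p)⁻¹ • ∑ i ∈ (ℛ K p).index, φ (T ((ℛ K p).right i)) • (ℛ K p).left i) * s,
    fun x ↦ ?_⟩
  have h₁ := congr(ψ (p * $(hφ (s * x))))
  have h₂ := congr(φ $(sum_right_integral_smul hS hT hψ p (s * x)))
  rw [← (ℛ K (s * x)).eq] at h₁
  simp only [map_sum, LinearMap.lTensor_tmul, TensorProduct.rid_tmul, Finset.mul_sum,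
    mul_smul_comm, map_smul, smul_eq_mul, mul_one] at h₁ h₂
  rw [mul_assoc, smul_mul_assoc, map_smul, smul_eq_mul, eq_inv_mul_iff_mul_eq₀ hp, mul_comm, ← h₁]
  simp only [Finset.sum_mul, map_sum, smul_mul_assoc, map_smul, smul_eq_mul]
  simpa only [mul_comm] using h₂

/-- Left and right translates of a left integral are the same functionals. -/
theorem exists_left_integral_mul_left_eq (hS : Function.Injective (antipode K (A := A)))
    (hT : Function.RightInverse T (antipode K))
    (hφ : ∀ a : A, TensorProduct.rid K A (φ.lTensor A (comul a)) = φ a • (1 : A))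
    (hψ : ∀ a : A, TensorProduct.lid K A (ψ.rTensor A (comul a)) = ψ a • (1 : A))
    (hφ0 : φ ≠ 0) (hψ0 : ψ ≠ 0) (s : A) : ∃ d, ∀ x, φ (s * x) = φ (x * d) := by
  obtain ⟨c, hc⟩ := exists_left_integral_mul_left_eq_right_integral hS hT hφ hψ hψ0 s
  obtain ⟨d, hd⟩ := exists_right_integral_mul_left_eq hS hT hφ hψ hφ0 c
  exact ⟨d, fun x ↦ (hc x).trans (hd x)⟩

end Integrals

end HopfAlgebra

theorem Finset.exists_fin_sum_mul_eq {ι A K : Type*} [Semiring A] [CommSemiring K] (φ : A → K)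
    (s : Finset ι) (c d : ι → A) :
    ∃ (n : ℕ) (c' d' : Fin n → A), ∀ x y : A,
      ∑ i ∈ s, φ (x * c i) * φ (y * d i) = ∑ i, φ (x * c' i) * φ (y * d' i) :=
  ⟨s.card, fun i ↦ c (s.equivFin.symm i), fun i ↦ d (s.equivFin.symm i), fun x y ↦ by
    rw [s.equivFin.symm.sum_comp fun i : s ↦ φ (x * c i) * φ (y * d i),
      s.sum_coe_sort fun i ↦ φ (x * c i) * φ (y * d i)]⟩

/-- The dual comultiplication maps `Â` into the multiplier algebra:
`Δ̂(b)(1 ⊗ b') ∈ Â ⊗ Â` and `(b ⊗ 1)Δ̂(b') ∈ Â ⊗ Â` for `b = φ(·a)`, `b' = φ(·a')`. -/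
theorem dual_comultiplication_multiplier
    {A : Type*} [Ring A] [HopfAlgebra ℂ A]
    (hS : Function.Bijective (antipode (R := ℂ) (A := A)))
    (φ : A →ₗ[ℂ] ℂ) (hφ0 : φ ≠ 0)
    (hφL : ∀ a : A,
      (TensorProduct.rid ℂ A) (LinearMap.lTensor A φ (Coalgebra.comul a)) = φ a • (1 : A)) :
    ∀ a a' : A,
      (∃ (n : ℕ) (c d : Fin n → A), ∀ x y : A,
        (TensorProduct.lid ℂ ℂ)
            (TensorProduct.map (φ ∘ₗ LinearMap.mulRight ℂ a ∘ₗ LinearMap.mulLeft ℂ x)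
              (φ ∘ₗ LinearMap.mulRight ℂ a') (Coalgebra.comul (R := ℂ) y)) =
          ∑ i, φ (x * c i) * φ (y * d i)) ∧
      (∃ (m : ℕ) (c' d' : Fin m → A), ∀ x y : A,
        (TensorProduct.lid ℂ ℂ)
            (TensorProduct.map (φ ∘ₗ LinearMap.mulRight ℂ a)
              (φ ∘ₗ LinearMap.mulRight ℂ a' ∘ₗ LinearMap.mulRight ℂ y)
              (Coalgebra.comul (R := ℂ) x)) =
          ∑ j, φ (x * c' j) * φ (y * d' j)) := by
  intro a a'
  let e := LinearEquiv.ofBijective (antipode ℂ (A := A)) hS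
  let T : A →ₗ[ℂ] A := e.symm.toLinearMap
  have hT : Function.RightInverse T (antipode ℂ) := e.apply_symm_apply
  have hT' : Function.LeftInverse T (antipode ℂ) := e.symm_apply_apply
  constructor
  · obtain ⟨n, c, d, h⟩ := (Coalgebra.Repr.arbitrary ℂ a').index.exists_fin_sum_mul_eq φ
      (fun i ↦ T ((Coalgebra.Repr.arbitrary ℂ a').left i) * a)
      (Coalgebra.Repr.arbitrary ℂ a').right
    refine ⟨n, c, d, fun x y ↦ ?_⟩
    rw [← h, ← (Coalgebra.Repr.arbitrary ℂ y).eq]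
    have := congr(φ (x * $(sum_left_integral_smul hS.1 hT hφL y a') * a))
    simpa [Finset.mul_sum, Finset.sum_mul, mul_assoc, mul_comm] using this
  · have hψL := comp_antipode_right_integral hS.1 hφL
    set ψ := φ ∘ₗ antipode ℂ
    have hψ0 : ψ ≠ 0 := fun h ↦ hφ0 <| LinearMap.ext fun x ↦ by
      simpa [ψ, hT x] using congr($h (T x))
    obtain ⟨b, hb⟩ := exists_left_integral_mul_right_eq hS.1 hT hT' hφL hψL hψ0 a
    choose f hf using exists_right_integral_mul_left_eq hS.1 hT hφL hψL hφ0
    choose g hg using exists_left_integral_mul_left_eq hS.1 hT hφL hψL hφ0 hψ0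
    obtain ⟨m, c, d, h⟩ := (Coalgebra.Repr.arbitrary ℂ b).index.exists_fin_sum_mul_eq φ
      (fun i ↦ f ((Coalgebra.Repr.arbitrary ℂ b).left i))
      (fun i ↦ a' * g (T ((Coalgebra.Repr.arbitrary ℂ b).right i)))
    refine ⟨m, c, d, fun x y ↦ ?_⟩
    rw [← h, ← (Coalgebra.Repr.arbitrary ℂ x).eq]
    have := congr(φ ($(sum_right_integral_smul hS.1 hT hψL b x) * (y * a')))
    simp only [Finset.sum_mul, map_sum, smul_mul_assoc, map_smul, smul_eq_mul, hf,
      fun a x ↦ hg (T a) x, mul_assoc] at this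
    simpa [hf, hb, mul_assoc] using this
end

section
/- Finite quantum groups are involutive and tracial: if A is a finite-dimensional Hopf *-algebra over ℂ admitting a positive faithful left integral φ, then S² = id (i.e. S(S(a)) = a for all a ∈ A) and φ is a trace (φ(ab) = φ(ba) for all a, b ∈ A). -/
open TensorProduct HopfAlgebra
open scoped ComplexOrder

/-- The star operation `a ⊗ b ↦ star a ⊗ star b` on `A ⊗[ℂ] A`. -/
noncomputable def starTensor {A : Type*} [Ring A] [StarRing A] [Algebra ℂ A]
    [StarModule ℂ A] : A ⊗[ℂ] A →+ A ⊗[ℂ] A :=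
  TensorProduct.liftAddHom
    { toFun := fun a =>
        { toFun := fun b => star a ⊗ₜ[ℂ] star b
          map_zero' := by simp
          map_add' := fun b₁ b₂ => by simp [star_add, TensorProduct.tmul_add] }
      map_zero' := by ext b; simp
      map_add' := fun a₁ a₂ => by ext b; simp [star_add, TensorProduct.add_tmul] }
    (fun c a b => by
      simp [star_smul, TensorProduct.smul_tmul, TensorProduct.tmul_smul])

namespace HopfAlgebra

open Coalgebra

section LeftIntegral

variable {R A : Type*} [CommRing R] [Ring A] [HopfAlgebra R A]

/-- The right slice `a ↦ ∑ f(a₍₂₎) a₍₁₎` of the comultiplication by a functional `f`. -/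
noncomputable def slice (f : A →ₗ[R] R) : A →ₗ[R] A :=
  (TensorProduct.rid R A).toLinearMap ∘ₗ f.lTensor A ∘ₗ comul

lemma slice_eq_sum {ι : Type*} (f : A →ₗ[R] R) {a : A} (r : Repr R a ι) :
    slice f a = ∑ i ∈ r.index, f (r.right i) • r.left i := by
  simp [slice, ← r.eq, map_sum]

lemma slice_counit (a : A) : slice (counit (R := R)) a = a := by
  simp [slice]

/-- Slicing turns composition of slices into iterated slicing. -/
lemma slice_comp_slice (f g : A →ₗ[R] R) (a : A) :
    slice (f ∘ₗ slice g) a = slice f (slice g a) := by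
  have h := congr((TensorProduct.rid R A) ((LinearMap.lTensor A
    (f ∘ₗ (TensorProduct.rid R A).toLinearMap ∘ₗ g.lTensor A))
    $(sum_tmul_tmul_eq (ℛ R a) (fun i ↦ ℛ R ((ℛ R a).left i)) (fun i ↦ ℛ R ((ℛ R a).right i)))))
  simp only [map_sum, LinearMap.lTensor_tmul, LinearMap.comp_apply, LinearEquiv.coe_coe,
    TensorProduct.rid_tmul, map_smul] at h
  rw [slice_eq_sum _ (ℛ R a), slice_eq_sum g (ℛ R a), map_sum]
  simp only [LinearMap.comp_apply, map_smul]
  simp_rw [slice_eq_sum f (ℛ R ((ℛ R a).left _)), slice_eq_sum g (ℛ R ((ℛ R a).right _)),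
    map_sum, Finset.sum_smul, map_smul]
  rw [← h]
  simp [Finset.smul_sum, smul_smul]

/-- Strong left invariance: `∑ S(a₍₁₎) φ(a₍₂₎ b) = ∑ b₍₁₎ φ(a b₍₂₎)`. -/
lemma antipode_slice {φ : A →ₗ[R] R} (hφL : ∀ a, slice φ a = φ a • (1 : A)) (a b : A) :
    antipode R (slice (φ ∘ₗ LinearMap.mulRight R b) a) = slice (φ ∘ₗ LinearMap.mulLeft R a) b := by
  have h := congr((LinearMap.mul' R A) ((TensorProduct.map (antipode R)
    ((TensorProduct.rid R A).toLinearMap ∘ₗ φ.lTensor A ∘ₗ LinearMap.mulRight R (comul b)))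
    $(sum_tmul_tmul_eq (ℛ R a) (fun i ↦ ℛ R ((ℛ R a).left i)) (fun i ↦ ℛ R ((ℛ R a).right i)))))
  simp only [map_sum, TensorProduct.map_tmul, LinearMap.mul'_apply] at h
  simp only [← Finset.mul_sum, ← map_sum, (ℛ R ((ℛ R a).right _)).eq] at h
  have key (x : A) : ((TensorProduct.rid R A).toLinearMap ∘ₗ φ.lTensor A ∘ₗ
      LinearMap.mulRight R (comul b)) (comul x) = φ (x * b) • (1 : A) := by
    rw [← hφL]
    simp [slice]
  have key' (x y : A) : ((TensorProduct.rid R A).toLinearMap ∘ₗ φ.lTensor A ∘ₗ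
      LinearMap.mulRight R (comul b)) (x ⊗ₜ y) = x * slice (φ ∘ₗ LinearMap.mulLeft R y) b := by
    rw [slice_eq_sum _ (ℛ R b), ← (ℛ R b).eq]
    simp [Finset.mul_sum]
  simp only [key, key', ← mul_assoc, ← Finset.sum_mul, sum_antipode_mul_eq_smul] at h
  rw [slice_eq_sum _ (ℛ R a), map_sum]
  simp only [mul_smul_comm, mul_one] at h
  simp only [LinearMap.comp_apply, LinearMap.mulRight_apply, map_smul]
  rw [← h]
  have e : ∑ i ∈ (ℛ R a).index, counit (R := R) ((ℛ R a).left i) • (ℛ R a).right i = a :=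
    sum_counit_smul _
  conv_rhs => rw [← e]
  rw [slice_eq_sum _ (ℛ R b)]
  simp_rw [slice_eq_sum _ (ℛ R b)]
  simp [Finset.sum_mul, Finset.sum_smul, Finset.smul_sum, smul_smul]
  rw [Finset.sum_comm]

section Integral

variable {φ : A →ₗ[R] R} {h : A}

lemma antipode_eq_slice (hφL : ∀ a, slice φ a = φ a • (1 : A))
    (hl : ∀ a, φ (a * h) = counit (R := R) a) (a : A) :
    antipode R a = slice (φ ∘ₗ LinearMap.mulLeft R a) h := by
  rw [← antipode_slice hφL]
  have : φ ∘ₗ LinearMap.mulRight R h = counit := by ext x; simp [hl]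
  rw [this, slice_counit]

/-- The square of the antipode is the Nakayama automorphism of `φ`. -/
lemma antipode_antipode_eq (hφL : ∀ a, slice φ a = φ a • (1 : A))
    (hl : ∀ a, φ (a * h) = counit (R := R) a) (hr : ∀ a, φ (h * a) = counit (R := R) a)
    {a b : A} (hab : ∀ x, φ (x * b) = φ (a * x)) :
    antipode R (antipode R a) = b := by
  have hab' : φ ∘ₗ LinearMap.mulLeft R a = φ ∘ₗ LinearMap.mulRight R b := by
    ext x; simp [hab]
  have hr' : φ ∘ₗ LinearMap.mulLeft R h = counit := by ext x; simp [hr]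
  rw [antipode_eq_slice hφL hl a, hab', antipode_slice hφL, hr', slice_counit]

lemma sum_integral_antipode_smul_antipode (hφL : ∀ a, slice φ a = φ a • (1 : A))
    (hl : ∀ a, φ (a * h) = counit (R := R) a) (a : A) {ι : Type*} (r : Repr R a ι) :
    ∑ i ∈ r.index, φ (antipode R (r.left i)) • antipode R (r.right i) =
      φ (antipode R a) • (1 : A) := by
  have e : φ ∘ₗ slice (φ ∘ₗ LinearMap.mulLeft R a) =
      ∑ i ∈ r.index, φ (antipode R (r.left i)) • (φ ∘ₗ LinearMap.mulLeft R (r.right i)) := by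
    ext x
    rw [LinearMap.comp_apply, ← antipode_slice hφL, slice_eq_sum _ r]
    simp [mul_comm]
  rw [← hφL, antipode_eq_slice hφL hl a, ← slice_comp_slice, e, slice_eq_sum _ (ℛ R h)]
  simp only [antipode_eq_slice hφL hl (r.right _), slice_eq_sum _ (ℛ R h)]
  simp only [Finset.smul_sum, LinearMap.sum_apply, Finset.sum_smul, LinearMap.smul_apply,
    smul_smul, smul_eq_mul]
  rw [Finset.sum_comm]

/-- A left integral is invariant under an injective antipode. -/
lemma integral_antipode [IsDomain R] (hφL : ∀ a, slice φ a = φ a • (1 : A))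
    (hl : ∀ a, φ (a * h) = counit (R := R) a) (hφ1 : φ 1 ≠ 0)
    (hS : Function.Injective (antipode R (A := A))) (a : A) :
    φ (antipode R a) = φ a := by
  have h1 : ∑ i ∈ (ℛ R a).index, φ (antipode R ((ℛ R a).left i)) • (ℛ R a).right i =
      φ (antipode R a) • (1 : A) := by
    apply hS
    simpa using sum_integral_antipode_smul_antipode hφL hl a (ℛ R a)
  have h2 := congr(φ (antipode R $(hφL a)))
  rw [slice_eq_sum _ (ℛ R a)] at h2
  have h1' := congr(φ $h1)
  simp only [map_sum, map_smul, smul_eq_mul, antipode_one] at h1' h2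
  apply mul_right_cancel₀ hφ1
  rw [← h1', ← h2]
  simp [mul_comm]

end Integral

end LeftIntegral

section Star

variable {A : Type*} [Ring A] [StarRing A] [HopfAlgebra ℂ A] [StarModule ℂ A]

/-- The counit of a Hopf `*`-algebra is a `*`-homomorphism. -/
lemma counit_star
    (hΔstar : ∀ a : A,
      Coalgebra.comul (R := ℂ) (star a) = starTensor (Coalgebra.comul (R := ℂ) a)) (a : A) :
    counit (R := ℂ) (star a) = star (counit (R := ℂ) a) := by
  let r := ℛ ℂ a
  let r' : Repr ℂ (star a) (A × A) :=
    ⟨r.index, fun i ↦ star (r.left i), fun i ↦ star (r.right i), by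
      rw [hΔstar, ← r.eq, map_sum]; rfl⟩
  have h1 : ∑ i ∈ r.index, counit (R := ℂ) (star (r.left i)) • star (r.right i) = star a :=
    sum_counit_smul r'
  have h2 : slice (counit (R := ℂ)) a = a := slice_counit a
  rw [slice_eq_sum _ r] at h2
  have h1' := congr(counit (R := ℂ) (star $h1))
  have h2' := congr(counit (R := ℂ) (star $h2))
  simp only [star_sum, star_smul, star_star, map_sum, map_smul, smul_eq_mul] at h1' h2'
  rw [← h2', ← h1', star_sum]
  simp [mul_comm]

end Star

section Faithful

variable {A : Type*} [Ring A] [StarRing A] [Algebra ℂ A] [FiniteDimensional ℂ A]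

/-- A faithful functional represents every functional. -/
lemma exists_apply_mul_eq {φ : A →ₗ[ℂ] ℂ} (hφfaith : ∀ a : A, φ (star a * a) = 0 → a = 0)
    (f : A →ₗ[ℂ] ℂ) : ∃ b, ∀ x, φ (x * b) = f x := by
  let T : A →ₗ[ℂ] Module.Dual ℂ A := (LinearMap.mul ℂ A).flip.compr₂ φ
  have hT : Function.Injective T := by
    rw [injective_iff_map_eq_zero]
    intro b hb
    exact hφfaith b congr($hb (star b))
  obtain ⟨b, hb⟩ := (LinearMap.injective_iff_surjective_of_finrank_eq_finrank
    Subspace.dual_finrank_eq.symm).1 hT f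
  exact ⟨b, fun x ↦ congr($hb x)⟩

end Faithful

/-- A faithful functional on a finite-dimensional Hopf `*`-algebra is dual to a two-sided
integral element. -/
lemma exists_two_sided_integral {A : Type*} [Ring A] [StarRing A] [HopfAlgebra ℂ A]
    [StarModule ℂ A] [FiniteDimensional ℂ A]
    (hΔstar : ∀ a : A,
      Coalgebra.comul (R := ℂ) (star a) = starTensor (Coalgebra.comul (R := ℂ) a))
    {φ : A →ₗ[ℂ] ℂ} (hφfaith : ∀ a : A, φ (star a * a) = 0 → a = 0) :
    ∃ h : A, (∀ a, φ (a * h) = counit (R := ℂ) a) ∧ ∀ a, φ (h * a) = counit (R := ℂ) a := by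
  obtain ⟨h, hl⟩ := exists_apply_mul_eq hφfaith (counit (R := ℂ))
  have hφh : φ h = 1 := by simpa using hl 1
  have hleft (a : A) : a * h = counit (R := ℂ) a • h := by
    rw [← sub_eq_zero]
    apply hφfaith
    rw [mul_sub, map_sub, ← mul_assoc, mul_smul_comm, map_smul, hl, hl, Bialgebra.counit_mul,
      smul_eq_mul, mul_comm, sub_self]
  have hright (a : A) : star h * a = counit (R := ℂ) a • star h := by
    have := congr(star $(hleft (star a)))
    simpa [counit_star hΔstar] using this
  have hne : star h * h ≠ 0 := fun h0 ↦ by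
    have : h = 0 := hφfaith h (by rw [h0, map_zero])
    simp [this] at hφh
  have hε : counit (R := ℂ) h ≠ 0 := fun h0 ↦ hne (by rw [hright, h0, zero_smul])
  have hε' : counit (R := ℂ) (star h) ≠ 0 := fun h0 ↦ hne (by rw [hleft, h0, zero_smul])
  have heq : counit (R := ℂ) (star h) • h = counit (R := ℂ) h • star h := by
    rw [← hleft, hright]
  refine ⟨h, hl, fun a ↦ ?_⟩
  have h3 : counit (R := ℂ) (star h) • (h * a) =
      counit (R := ℂ) (star h) • (counit (R := ℂ) a • h) := by
    rw [← smul_mul_assoc, heq, smul_mul_assoc, hright, smul_comm, ← heq, smul_comm]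
  rw [smul_right_injective A hε' h3, map_smul, hφh, smul_eq_mul, mul_one]

end HopfAlgebra

/-- Finite quantum groups are involutive and tracial: a finite-dimensional Hopf `*`-algebra
over `ℂ` with a positive faithful left integral `φ` satisfies `S² = id`, and `φ` is a trace. -/
theorem finite_quantum_group_S2_eq_id_and_integral_is_trace
    {A : Type*} [Ring A] [StarRing A] [HopfAlgebra ℂ A] [StarModule ℂ A]
    [FiniteDimensional ℂ A]
    (hΔstar : ∀ a : A,
      Coalgebra.comul (R := ℂ) (star a) = starTensor (Coalgebra.comul (R := ℂ) a))
    (φ : A →ₗ[ℂ] ℂ) (hφ0 : φ ≠ 0)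
    (hφL : ∀ a : A,
      (TensorProduct.rid ℂ A) (LinearMap.lTensor A φ (Coalgebra.comul a)) = φ a • (1 : A))
    (hφpos : ∀ a : A, 0 ≤ φ (star a * a))
    (hφfaith : ∀ a : A, φ (star a * a) = 0 → a = 0) :
    (∀ a : A, antipode (R := ℂ) (antipode (R := ℂ) a) = a) ∧
      ∀ a b : A, φ (a * b) = φ (b * a) := by
  change ∀ a, slice φ a = φ a • (1 : A) at hφL
  have hnondeg {a b : A} (hab : ∀ x, φ (x * a) = φ (x * b)) : a = b := by
    rw [← sub_eq_zero]
    apply hφfaith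
    rw [mul_sub, map_sub, hab, sub_self]
  obtain ⟨h, hl, hr⟩ := exists_two_sided_integral hΔstar hφfaith
  have hnak (a b : A) : φ (b * antipode ℂ (antipode ℂ a)) = φ (a * b) := by
    obtain ⟨c, hc⟩ := exists_apply_mul_eq hφfaith (φ ∘ₗ LinearMap.mulLeft ℂ a)
    rw [antipode_antipode_eq hφL hl hr hc, hc]
    rfl
  have hS : Function.Injective (antipode ℂ (A := A)) := by
    rw [injective_iff_map_eq_zero]
    intro a ha
    apply star_eq_zero.1
    apply hφfaith
    rw [star_star, ← hnak, ha, map_zero, mul_zero, map_zero]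
  have hφ1 : φ 1 ≠ 0 := fun h1 ↦ hφ0 <| by
    have : (1 : A) = 0 := hφfaith 1 (by simpa using h1)
    ext a
    rw [← mul_one a, this, mul_zero, map_zero, map_zero]
  have hφS := integral_antipode hφL hl hφ1 hS
  have hS4 (b : A) : antipode ℂ (antipode ℂ (antipode ℂ (antipode ℂ b))) = b := by
    apply hnondeg
    intro a
    rw [hnak, ← hφS (_ * a), antipode_mul_antidistrib, hnak, ← antipode_mul_antidistrib, hφS]
  have hS2 (a : A) : antipode ℂ (antipode ℂ a) = a := by
    set x := antipode ℂ (antipode ℂ a) - a with hx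
    have hSx : antipode ℂ (antipode ℂ x) = -x := by
      rw [hx, map_sub, map_sub, hS4, neg_sub]
    have h1 : -φ (star x * x) = φ (x * star x) := by
      rw [← hnak x, hSx, mul_neg, map_neg]
    have h2 : 0 ≤ φ (x * star x) := by simpa using hφpos (star x)
    rw [← h1, neg_nonneg] at h2
    exact sub_eq_zero.1 (hφfaith x (le_antisymm h2 (hφpos x)))
  exact ⟨hS2, fun a b ↦ by rw [← hnak, hS2]⟩
end
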